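/- Fix an integer N ≥ 1, τ ∈ (0,1), a > 0, t > 0 and y ∈ W_N^+. For u ∈ ℝ define g_N(u) = ∫_{Γ_a} dz₁ ⋯ ∫_{Γ_a} dz_N ∏_{1≤i<j≤N} (z_j − z_i)/(z_j − τ z_i) · ∏_{j=1}^N (1/z_j) e^{z_j(u − y_j)} e^{z_j² t/2}. Then lim_{u→∞} g_N(u) = 1. -/

import Mathlib

open MeasureTheory Filter Set

/-- The point on the vertical contour `Γ_a` at height `φ`. -/
noncomputable def lineZ (a φ : ℝ) : ℂ := (a : ℂ) + φ * Complex.I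

/-- The distribution function of the rightmost particle,
`g_N(u) = ∫_{Γ_a} dz₁ ⋯ ∫_{Γ_a} dz_N ∏_{i<j} (z_j − z_i)/(z_j − τ z_i) ·
∏_j (1/z_j) e^{z_j(u − y_j)} e^{z_j² t/2}`, each contour integral carrying the
conventional prefactor `1/(2πi)`. -/
noncomputable def gDist (N : ℕ) (τ a t : ℝ) (y : Fin N → ℝ) (u : ℝ) : ℂ :=
  (1 / (2 * Real.pi)) ^ N *
    ∫ φ : Fin N → ℝ,
      (∏ pr ∈ Finset.univ.filter (fun pr : Fin N × Fin N => pr.1 < pr.2),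
        ((lineZ a (φ pr.2) - lineZ a (φ pr.1)) /
          (lineZ a (φ pr.2) - (τ : ℂ) * lineZ a (φ pr.1)))) *
      ∏ j : Fin N,
        (1 / lineZ a (φ j)) * Complex.exp (lineZ a (φ j) * ((u : ℂ) - (y j : ℂ))) *
          Complex.exp (lineZ a (φ j) ^ 2 * (t : ℂ) / 2)

theorem lineZ_ne_zero {a : ℝ} (ha : a ≠ 0) (x : ℝ) : lineZ a x ≠ 0 :=
  fun h => ha (by simpa [lineZ] using congrArg Complex.re h)

@[simp] theorem lineZ_re (a x : ℝ) : (lineZ a x).re = a := by simp [lineZ]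

@[simp] theorem lineZ_im (a x : ℝ) : (lineZ a x).im = x := by simp [lineZ]

theorem continuous_lineZ (a : ℝ) : Continuous (lineZ a) := by unfold lineZ; fun_prop

theorem integral_one_div_lineZ {a : ℝ} (ha : a ≠ 0) (T : ℝ) :
    ∫ x in (-T)..T, 1 / lineZ a x = ((2 * Real.arctan (T / a) : ℝ) : ℂ) := by
  have hpos (x : ℝ) : a ^ 2 + x ^ 2 ≠ 0 := by positivity
  have hd (x : ℝ) : HasDerivAt (fun x : ℝ => ((Real.arctan (x / a) : ℝ) : ℂ)
      - Complex.I / 2 * ((Real.log (a ^ 2 + x ^ 2) : ℝ) : ℂ)) (1 / lineZ a x) x := by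
    have h1 := (((hasDerivAt_id' x).div_const a).arctan).ofReal_comp
    have h2 := (((hasDerivAt_pow 2 x).const_add (a ^ 2)).log (hpos x)).ofReal_comp
    refine (h1.sub (h2.const_mul (Complex.I / 2))).congr_deriv ?_
    have h3 : (a : ℂ) ^ 2 + (x : ℂ) ^ 2 ≠ 0 := by exact_mod_cast hpos x
    have h4 : (a : ℂ) ≠ 0 := by exact_mod_cast ha
    have h5 := lineZ_ne_zero ha x
    have h6 : lineZ a x * (a - x * Complex.I) = a ^ 2 + x ^ 2 := by
      simp only [lineZ]; ring_nf; simp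
    rw [eq_comm, one_div, ← mul_right_inj' h5, mul_inv_cancel₀ h5]
    have h7 : (1 : ℂ) + (x / a) ^ 2 ≠ 0 := by
      rw [div_pow, ← div_self (pow_ne_zero 2 h4), ← add_div]
      exact div_ne_zero h3 (pow_ne_zero 2 h4)
    have h8 : (1 : ℂ) / (1 + (x / a) ^ 2) * (1 / a) = a / (a ^ 2 + x ^ 2) := by
      field_simp
    push_cast
    rw [h8]
    have : (a : ℂ) / (a ^ 2 + x ^ 2) - Complex.I / 2 * (2 * x ^ 1 / (a ^ 2 + x ^ 2)) =
      (a - x * Complex.I) / (a ^ 2 + x ^ 2) := by norm_num; ring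
    rw [this, ← mul_div_assoc, h6, div_self h3]
  rw [intervalIntegral.integral_eq_sub_of_hasDerivAt (fun x _ => hd x)]
  · simp [neg_div, Real.arctan_neg]
    ring
  · apply Continuous.intervalIntegrable
    exact continuous_const.div (continuous_lineZ a) (lineZ_ne_zero ha)

theorem tendsto_integral_one_div_lineZ_of_pos {a : ℝ} (ha : 0 < a) :
    Tendsto (fun T : ℝ => ∫ x in (-T)..T, 1 / lineZ a x) atTop (nhds (Real.pi : ℂ)) := by
  simp_rw [integral_one_div_lineZ ha.ne']
  have h := (Real.tendsto_arctan_atTop.mono_right nhdsWithin_le_nhds).comp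
    (tendsto_id.atTop_div_const ha)
  have h2 := (Complex.continuous_ofReal.tendsto _).comp (h.const_mul 2)
  rwa [mul_div_cancel₀ _ two_ne_zero] at h2

theorem tendsto_integral_one_div_lineZ_of_neg {c : ℝ} (hc : 0 < c) :
    Tendsto (fun T : ℝ => ∫ x in (-T)..T, 1 / lineZ (-c) x) atTop (nhds (-Real.pi : ℂ)) := by
  refine (tendsto_integral_one_div_lineZ_of_pos hc).neg.congr fun T => ?_
  rw [integral_one_div_lineZ hc.ne', integral_one_div_lineZ (neg_ne_zero.2 hc.ne'), div_neg,
    Real.arctan_neg]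
  push_cast
  ring

/-- Shifting a vertical contour to the left across the simple pole of `f z / z` at the origin. -/
theorem integral_div_lineZ_eq_add {f : ℂ → ℂ} {a c M : ℝ} (ha : 0 < a) (hc : 0 < c) {U : Set ℂ}
    (hUo : IsOpen U) (hU : ∀ z : ℂ, -c ≤ z.re → z.re ≤ a → z ∈ U) (hf : DifferentiableOn ℂ f U)
    (hM : ∀ z : ℂ, -c ≤ z.re → z.re ≤ a → ‖f z‖ ≤ M)
    (h₁ : Integrable fun x => f (lineZ a x) / lineZ a x)
    (h₂ : Integrable fun x => f (lineZ (-c) x) / lineZ (-c) x) :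
    ∫ x, f (lineZ a x) / lineZ a x =
      2 * Real.pi * f 0 + ∫ x, f (lineZ (-c) x) / lineZ (-c) x := by
  have h0U : (0 : ℂ) ∈ U := hU 0 (by simpa using hc.le) (by simpa using ha.le)
  have hg : DifferentiableOn ℂ (dslope f 0) U :=
    (Complex.differentiableOn_dslope (hUo.mem_nhds h0U)).2 hf
  have hgz {z : ℂ} (hz : z ≠ 0) : dslope f 0 z = f z / z - f 0 * (1 / z) := by
    rw [dslope_of_ne _ hz, slope_def_field, sub_zero]
    ring
  have hline {b : ℝ} (hb : b ≠ 0) (hi : Integrable fun x => f (lineZ b x) / lineZ b x) (T : ℝ) :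
      ∫ y in (-T)..T, dslope f 0 (b + y * Complex.I) =
        (∫ x in (-T)..T, f (lineZ b x) / lineZ b x) - f 0 * ∫ x in (-T)..T, 1 / lineZ b x := by
    rw [← intervalIntegral.integral_const_mul, ← intervalIntegral.integral_sub]
    · exact intervalIntegral.integral_congr fun y _ => hgz (lineZ_ne_zero hb y)
    · exact hi.intervalIntegrable
    · apply Continuous.intervalIntegrable
      exact continuous_const.mul (continuous_const.div (continuous_lineZ b) (lineZ_ne_zero hb))
  have hlim {b : ℝ} {l : ℂ} (hb : b ≠ 0) (hi : Integrable fun x => f (lineZ b x) / lineZ b x)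
      (hl : Tendsto (fun T : ℝ => ∫ x in (-T)..T, 1 / lineZ b x) atTop (nhds l)) :
      Tendsto (fun T : ℝ => ∫ y in (-T)..T, dslope f 0 (b + y * Complex.I)) atTop
        (nhds ((∫ x, f (lineZ b x) / lineZ b x) - f 0 * l)) := by
    simp_rw [hline hb hi]
    exact (intervalIntegral_tendsto_integral hi tendsto_neg_atTop_atBot tendsto_id).sub
      (hl.const_mul _)
  have hhor (s : ℝ) (hs : s = 1 ∨ s = -1) :
      Tendsto (fun T : ℝ => ∫ x in (-c)..a, dslope f 0 (x + (s * T : ℝ) * Complex.I)) atTop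
        (nhds 0) := by
    have h : Tendsto (fun T : ℝ => (M + ‖f 0‖) / T * |a - -c|) atTop (nhds 0) := by
      simpa using ((tendsto_const_nhds (x := M + ‖f 0‖)).div_atTop tendsto_id).mul_const |a - -c|
    refine squeeze_zero_norm' ?_ h
    filter_upwards [eventually_gt_atTop 0] with T hT
    refine intervalIntegral.norm_integral_le_of_norm_le_const fun x hx => ?_
    rw [uIoc_of_le (by linarith)] at hx
    set z : ℂ := x + (s * T : ℝ) * Complex.I with hz
    have hre : z.re = x := by simp [hz]
    have him : |z.im| = T := by
      rcases hs with rfl | rfl <;> simp [hz, abs_of_pos hT]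
    have hzT : T ≤ ‖z‖ := him ▸ Complex.abs_im_le_norm z
    have hz0 : z ≠ 0 := norm_pos_iff.1 (hT.trans_le hzT)
    rw [dslope_of_ne _ hz0, slope_def_field, sub_zero, norm_div]
    have hMz := hM z (hre ▸ hx.1.le) (hre ▸ hx.2)
    exact div_le_div₀ (add_nonneg ((norm_nonneg _).trans hMz) (norm_nonneg _))
      ((norm_sub_le _ _).trans (by gcongr)) hT hzT
  have hrect (T : ℝ) := Complex.integral_boundary_rect_eq_zero_of_differentiableOn (dslope f 0)
    ⟨-c, -1 * T⟩ ⟨a, 1 * T⟩ (hg.mono fun z hz => by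
      have h : z.re ∈ uIcc (-c) a := hz.1
      rw [uIcc_of_le (by linarith)] at h
      exact hU z h.1 h.2)
  have key := (((hhor (-1) (Or.inr rfl)).sub (hhor 1 (Or.inl rfl))).add
    ((hlim ha.ne' h₁ (tendsto_integral_one_div_lineZ_of_pos ha)).const_smul Complex.I)).sub
    ((hlim (neg_ne_zero.2 hc.ne') h₂
      (tendsto_integral_one_div_lineZ_of_neg hc)).const_smul Complex.I)
  have h0 := tendsto_nhds_unique (key.congr fun T => by simpa using hrect T)
    (tendsto_const_nhds (x := (0 : ℂ)))
  simp only [smul_eq_mul, sub_zero, zero_add] at h0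
  rw [← mul_sub] at h0
  linear_combination (mul_eq_zero.1 h0).resolve_left Complex.I_ne_zero

/-- The part of the integrand of `gDist` that depends on the innermost variable `z`, without the
factor `1 / z`; the remaining variables are `w`, and `v = u - y₁`. -/
noncomputable def innerFactor {n : ℕ} (τ t : ℝ) (w : Fin n → ℂ) (v : ℝ) (z : ℂ) : ℂ :=
  (∏ j, (w j - z) / (w j - τ * z)) * (Complex.exp (z * v) * Complex.exp (z ^ 2 * t / 2))

theorem sub_mul_ne_zero {τ a : ℝ} {w z : ℂ} (hw : w.re = a) (hz : τ * z.re < a) : w - τ * z ≠ 0 := by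
  intro h
  have := congrArg Complex.re h
  simp [hw] at this
  linarith

theorem innerFactor_zero {n : ℕ} (τ t : ℝ) {w : Fin n → ℂ} (hw : ∀ j, w j ≠ 0) (v : ℝ) :
    innerFactor τ t w v 0 = 1 := by
  simp [innerFactor, hw]

theorem differentiableOn_innerFactor {n : ℕ} {τ a : ℝ} (t : ℝ) {w : Fin n → ℂ} (hw : ∀ j, (w j).re = a) (v : ℝ) :
    DifferentiableOn ℂ (innerFactor τ t w v) {z | τ * z.re < a} := by
  unfold innerFactor
  refine DifferentiableOn.mul (DifferentiableOn.fun_finsetProd fun j _ => ?_) (by fun_prop)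
  exact DifferentiableOn.div (by fun_prop) (by fun_prop) fun z hz => sub_mul_ne_zero (hw j) hz

theorem norm_sub_div_le {τ a : ℝ} (hτ : τ ∈ Ioo (0 : ℝ) 1) (ha : 0 < a) {w z : ℂ}
    (hw : w.re = a) (hz : z.re ≤ a) :
    ‖(w - z) / (w - τ * z)‖ ≤ Real.exp ((a * (1 - τ))⁻¹ * ‖z‖) := by
  have hτ1 : 0 < 1 - τ := sub_pos.2 hτ.2
  have hre : a * (1 - τ) ≤ (w - τ * z).re := by
    simp [hw]
    nlinarith [hτ.1]
  have hpos : 0 < a * (1 - τ) := mul_pos ha hτ1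
  have hn : a * (1 - τ) ≤ ‖w - τ * z‖ := hre.trans (Complex.re_le_norm _)
  have hne : w - τ * z ≠ 0 := norm_pos_iff.1 (hpos.trans_le hn)
  have heq : (w - z) / (w - τ * z) = 1 - (1 - τ : ℝ) * z / (w - τ * z) := by
    rw [eq_sub_iff_add_eq, ← add_div, div_eq_one_iff_eq hne]
    push_cast
    ring
  rw [heq]
  calc _ ≤ ‖(1 : ℂ)‖ + ‖(1 - τ : ℝ) * z / (w - τ * z)‖ := norm_sub_le _ _
    _ = 1 + (1 - τ) * ‖z‖ / ‖w - τ * z‖ := by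
      rw [norm_one, norm_div, norm_mul, Complex.norm_real, Real.norm_of_nonneg hτ1.le]
    _ ≤ 1 + 1 * ‖z‖ / (a * (1 - τ)) := by
      gcongr
      linarith [hτ.1]
    _ = (a * (1 - τ))⁻¹ * ‖z‖ + 1 := by ring
    _ ≤ _ := Real.add_one_le_exp _

theorem exists_norm_innerFactor_le (n : ℕ) {τ a c t : ℝ} (hτ : τ ∈ Ioo (0 : ℝ) 1) (ha : 0 < a)
    (hc : 0 < c) (ht : 0 < t) :
    ∃ C, 0 ≤ C ∧ ∀ (w : Fin n → ℂ), (∀ j, (w j).re = a) → ∀ (v : ℝ) (z : ℂ), -c ≤ z.re → z.re ≤ a →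
      ‖innerFactor τ t w v z‖ ≤ C * Real.exp (z.re * v) * Real.exp (-(t / 4) * z.im ^ 2) := by
  set K := (a * (1 - τ))⁻¹
  have hK : 0 ≤ K := inv_nonneg.2 (mul_nonneg ha.le (sub_nonneg.2 hτ.2.le))
  set L := n * K
  have hL : 0 ≤ L := by positivity
  refine ⟨Real.exp (L * (a + c) + L ^ 2 / t + (a + c) ^ 2 * t / 2), (Real.exp_pos _).le,
    fun w hw v z hz₁ hz₂ => ?_⟩
  have hprod : ‖∏ j, (w j - z) / (w j - τ * z)‖ ≤ Real.exp (L * ‖z‖) := by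
    rw [norm_prod]
    calc _ ≤ ∏ _j : Fin n, Real.exp (K * ‖z‖) :=
          Finset.prod_le_prod (fun _ _ => norm_nonneg _)
            fun j _ => norm_sub_div_le hτ ha (hw j) hz₂
      _ = _ := by
        rw [Finset.prod_const, Finset.card_univ, Fintype.card_fin, ← Real.exp_nat_mul, mul_assoc]
  have hre : |z.re| ≤ a + c := abs_le.2 ⟨by linarith, by linarith⟩
  have hz : ‖z‖ ≤ (a + c) + |z.im| := (Complex.norm_le_abs_re_add_abs_im z).trans (by gcongr)
  have hsq : z.re ^ 2 ≤ (a + c) ^ 2 := by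
    rw [← sq_abs]
    gcongr
  have h1 : L * ‖z‖ ≤ L * (a + c) + L * |z.im| := by
    rw [← mul_add]
    gcongr
  have h2 : L * |z.im| ≤ L ^ 2 / t + t / 4 * z.im ^ 2 := by
    have : L ^ 2 / t + t / 4 * z.im ^ 2 - L * |z.im| = (L - t / 2 * |z.im|) ^ 2 / t := by
      rw [← sq_abs z.im]
      field_simp
      ring
    have : 0 ≤ (L - t / 2 * |z.im|) ^ 2 / t := by positivity
    linarith
  have h3 : (z ^ 2 * t / 2).re = z.re ^ 2 * t / 2 - z.im ^ 2 * t / 2 := by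
    have : z ^ 2 * t / 2 = z ^ 2 * ((t / 2 : ℝ) : ℂ) := by push_cast; ring
    rw [this, Complex.re_mul_ofReal, pow_two, Complex.mul_re]
    ring
  rw [innerFactor, norm_mul, norm_mul, Complex.norm_exp, Complex.norm_exp, Complex.re_mul_ofReal,
    h3]
  calc _ ≤ Real.exp (L * ‖z‖) *
        (Real.exp (z.re * v) * Real.exp (z.re ^ 2 * t / 2 - z.im ^ 2 * t / 2)) := by gcongr
    _ = Real.exp (L * ‖z‖ + (z.re * v + (z.re ^ 2 * t / 2 - z.im ^ 2 * t / 2))) := by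
      rw [Real.exp_add, Real.exp_add]
    _ ≤ Real.exp (L * (a + c) + L ^ 2 / t + (a + c) ^ 2 * t / 2 + z.re * v +
        -(t / 4) * z.im ^ 2) := by
      refine Real.exp_le_exp.2 ?_
      have : z.re ^ 2 * t ≤ (a + c) ^ 2 * t := by gcongr
      linarith
    _ = _ := by rw [Real.exp_add, Real.exp_add]

theorem norm_innerFactor_div_lineZ_le {n : ℕ} {τ a b c t C v : ℝ} (hb : b ≠ 0) (hcb : -c ≤ b)
    (hba : b ≤ a) {w : Fin n → ℂ} (hC : ∀ z : ℂ, -c ≤ z.re → z.re ≤ a →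
      ‖innerFactor τ t w v z‖ ≤ C * Real.exp (z.re * v) * Real.exp (-(t / 4) * z.im ^ 2)) (x : ℝ) :
    ‖innerFactor τ t w v (lineZ b x) / lineZ b x‖ ≤
      C * Real.exp (b * v) / |b| * Real.exp (-(t / 4) * x ^ 2) := by
  have h := hC (lineZ b x) (by simpa) (by simpa)
  have hn : |b| ≤ ‖lineZ b x‖ := by simpa using Complex.abs_re_le_norm (lineZ b x)
  rw [lineZ_re, lineZ_im] at h
  rw [norm_div, div_mul_eq_mul_div]
  exact div_le_div₀ ((norm_nonneg _).trans h) h (abs_pos.2 hb) hn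

theorem continuous_innerFactor_div_lineZ {n : ℕ} {τ a b : ℝ} (hb : b ≠ 0) (hba : τ * b < a) (t : ℝ)
    {w : Fin n → ℂ} (hw : ∀ j, (w j).re = a) (v : ℝ) :
    Continuous fun x => innerFactor τ t w v (lineZ b x) / lineZ b x := by
  refine Continuous.div ?_ (continuous_lineZ b) (lineZ_ne_zero hb)
  rw [← continuousOn_univ]
  exact (differentiableOn_innerFactor t hw v).continuousOn.comp (continuous_lineZ b).continuousOn
    fun x _ => by simpa using hba

/-- The innermost integral of `gDist` equals the residue at `0` up to an error which is
exponentially small in `v`, uniformly in the other variables. -/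
theorem exists_norm_integral_innerFactor_sub_le (n : ℕ) {τ a c t : ℝ} (hτ : τ ∈ Ioo (0 : ℝ) 1)
    (ha : 0 < a) (hc : 0 < c) (ht : 0 < t) :
    ∃ D, ∀ (w : Fin n → ℂ), (∀ j, (w j).re = a) → ∀ v : ℝ,
      ‖(∫ x, innerFactor τ t w v (lineZ a x) / lineZ a x) - 2 * Real.pi‖ ≤
        D * Real.exp (-c * v) := by
  obtain ⟨C, hC0, hC⟩ := exists_norm_innerFactor_le n hτ ha hc ht
  have hgauss : Integrable fun x : ℝ => Real.exp (-(t / 4) * x ^ 2) :=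
    integrable_exp_neg_mul_sq (by positivity)
  refine ⟨C / c * ∫ x : ℝ, Real.exp (-(t / 4) * x ^ 2), fun w hw v => ?_⟩
  have hbound {b : ℝ} (hb : b ≠ 0) (hcb : -c ≤ b) (hba : b ≤ a) :=
    norm_innerFactor_div_lineZ_le hb hcb hba (hC w hw v)
  have hτa {x : ℝ} (hx : x ≤ a) : τ * x < a := by nlinarith [hτ.1, hτ.2]
  have hint {b : ℝ} (hb : b ≠ 0) (hcb : -c ≤ b) (hba : b ≤ a) :
      Integrable fun x => innerFactor τ t w v (lineZ b x) / lineZ b x :=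
    (hgauss.const_mul _).mono'
      (continuous_innerFactor_div_lineZ hb (hτa hba) t hw v).aestronglyMeasurable
      (Eventually.of_forall (hbound hb hcb hba))
  have hca : -c ≤ a := by linarith
  rw [integral_div_lineZ_eq_add ha hc (U := {z | τ * z.re < a})
    (isOpen_lt (by fun_prop) continuous_const) (fun z _ hz => hτa hz)
    (differentiableOn_innerFactor t hw v) (M := C * Real.exp ((a + c) * |v|)) ?_
    (hint ha.ne' hca le_rfl) (hint (neg_ne_zero.2 hc.ne') le_rfl hca),
    innerFactor_zero τ t fun j hj => ha.ne' (by simpa [hj] using (hw j).symm), mul_one,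
    add_sub_cancel_left]
  · refine (norm_integral_le_of_norm_le (hgauss.const_mul _)
      (Eventually.of_forall (hbound (neg_ne_zero.2 hc.ne') le_rfl hca))).trans_eq ?_
    rw [integral_const_mul, abs_neg, abs_of_pos hc]
    ring
  · intro z hz₁ hz₂
    refine (hC w hw v z hz₁ hz₂).trans ?_
    refine (mul_le_of_le_one_right (by positivity) (Real.exp_le_one_iff.2 ?_)).trans ?_
    · nlinarith [sq_nonneg z.im]
    · have : z.re * v ≤ (a + c) * |v| := by
        refine (le_abs_self _).trans ?_
        rw [abs_mul]
        gcongr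
        exact abs_le.2 ⟨by linarith, by linarith⟩
      gcongr

/-- The integrand of `gDist`. -/
noncomputable def gIntegrand (N : ℕ) (τ a t : ℝ) (y : Fin N → ℝ) (u : ℝ) (φ : Fin N → ℝ) : ℂ :=
  (∏ pr ∈ Finset.univ.filter (fun pr : Fin N × Fin N => pr.1 < pr.2),
    ((lineZ a (φ pr.2) - lineZ a (φ pr.1)) /
      (lineZ a (φ pr.2) - (τ : ℂ) * lineZ a (φ pr.1)))) *
  ∏ j : Fin N,
    (1 / lineZ a (φ j)) * Complex.exp (lineZ a (φ j) * ((u : ℂ) - (y j : ℂ))) *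
      Complex.exp (lineZ a (φ j) ^ 2 * (t : ℂ) / 2)

theorem gDist_eq (N : ℕ) (τ a t : ℝ) (y : Fin N → ℝ) (u : ℝ) :
    gDist N τ a t y u = (1 / (2 * Real.pi)) ^ N * ∫ φ, gIntegrand N τ a t y u φ := rfl

theorem gIntegrand_cons {n : ℕ} (τ a t : ℝ) (y : Fin (n + 1) → ℝ) (u x : ℝ) (φ : Fin n → ℝ) :
    gIntegrand (n + 1) τ a t y u (Fin.cons x φ : Fin (n + 1) → ℝ) =
      innerFactor τ t (fun j => lineZ a (φ j)) (u - y 0) (lineZ a x) / lineZ a x *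
        gIntegrand n τ a t (Fin.tail y) u φ := by
  simp only [gIntegrand, innerFactor, Finset.prod_filter, Fintype.prod_prod_type,
    Fin.prod_univ_succ, Fin.cons_zero, Fin.cons_succ, Fin.succ_pos,
    Fin.not_lt_zero, Fin.succ_lt_succ_iff, if_true, if_false, one_mul, Fin.tail]
  push_cast
  ring

theorem continuous_gIntegrand {N : ℕ} {τ a : ℝ} (hτ : τ ∈ Ioo (0 : ℝ) 1) (ha : 0 < a) (t : ℝ)
    (y : Fin N → ℝ) (u : ℝ) : Continuous (gIntegrand N τ a t y u) := by
  have h (j : Fin N) : Continuous fun φ : Fin N → ℝ => lineZ a (φ j) :=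
    (continuous_lineZ a).comp (continuous_apply j)
  refine Continuous.mul (continuous_finsetProd _ fun pr _ => ?_)
    (continuous_finsetProd _ fun j _ => ?_)
  · refine ((h _).sub (h _)).div ((h _).sub (continuous_const.mul (h _))) fun φ => ?_
    refine sub_mul_ne_zero (lineZ_re _ _) ?_
    rw [lineZ_re]
    nlinarith [hτ.2]
  · have hj := h j
    refine ((continuous_const.div hj fun φ => lineZ_ne_zero ha.ne' _).mul ?_).mul ?_ <;> fun_prop

theorem norm_gIntegrand (N : ℕ) (τ a t : ℝ) (y : Fin N → ℝ) (u : ℝ) (φ : Fin N → ℝ) :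
    ‖gIntegrand N τ a t y u φ‖ = Real.exp (N * a * u) * ‖gIntegrand N τ a t y 0 φ‖ := by
  have h : gIntegrand N τ a t y u φ =
      (∏ j : Fin N, Complex.exp (lineZ a (φ j) * u)) * gIntegrand N τ a t y 0 φ := by
    unfold gIntegrand
    rw [mul_left_comm, ← Finset.prod_mul_distrib]
    congr 1
    refine Finset.prod_congr rfl fun j _ => ?_
    rw [mul_sub, sub_eq_add_neg, Complex.exp_add, mul_sub, Complex.ofReal_zero, mul_zero, zero_sub]
    ring
  have hj (j : Fin N) : ‖Complex.exp (lineZ a (φ j) * u)‖ = Real.exp (a * u) := by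
    rw [Complex.norm_exp, Complex.re_mul_ofReal, lineZ_re]
  rw [h, norm_mul, norm_prod, Finset.prod_congr rfl fun j _ => hj j, Finset.prod_const,
    Finset.card_univ, Fintype.card_fin, ← Real.exp_nat_mul, mul_assoc]

theorem measurePreserving_cons (n : ℕ) :
    MeasurePreserving (MeasurableEquiv.piFinSuccAbove (fun _ : Fin (n + 1) => ℝ) 0).symm
      (volume.prod volume) volume :=
  (volume_preserving_piFinSuccAbove (fun _ : Fin (n + 1) => ℝ) 0).symm

theorem piFinSuccAbove_zero_symm_apply {n : ℕ} (p : ℝ × (Fin n → ℝ)) :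
    (MeasurableEquiv.piFinSuccAbove (fun _ : Fin (n + 1) => ℝ) 0).symm p =
      (Fin.cons p.1 p.2 : Fin (n + 1) → ℝ) := by
  ext j
  refine Fin.cases ?_ (fun i => ?_) j <;> simp

theorem integrable_gIntegrand {τ a t : ℝ} (hτ : τ ∈ Ioo (0 : ℝ) 1) (ha : 0 < a) (ht : 0 < t) :
    ∀ (N : ℕ) (y : Fin N → ℝ) (u : ℝ), Integrable (gIntegrand N τ a t y u)
  | 0, y, u => by
    have : gIntegrand 0 τ a t y u = fun _ => 1 := by
      ext φ
      simp [gIntegrand]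
    rw [this, volume_pi, Measure.pi_of_empty _ (fun i => i.elim0)]
    exact integrable_const _
  | n + 1, y, u => by
    obtain ⟨C, hC0, hC⟩ := exists_norm_innerFactor_le n hτ ha ha ht
    have hgauss : Integrable fun x : ℝ => Real.exp (-(t / 4) * x ^ 2) :=
      integrable_exp_neg_mul_sq (by positivity)
    rw [← (measurePreserving_cons n).integrable_comp_emb (MeasurableEquiv.measurableEmbedding _)]
    refine ((hgauss.const_mul (C * Real.exp (a * (u - y 0)) / |a|)).mul_prod
      (integrable_gIntegrand hτ ha ht n (Fin.tail y) u).norm).mono'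
      ((continuous_gIntegrand hτ ha t y u).measurable.comp
        (MeasurableEquiv.measurable _)).aestronglyMeasurable (Eventually.of_forall fun p => ?_)
    rw [Function.comp_apply, piFinSuccAbove_zero_symm_apply, gIntegrand_cons, norm_mul]
    gcongr
    exact norm_innerFactor_div_lineZ_le ha.ne' (by linarith) le_rfl
      (hC _ (fun j => lineZ_re _ _) _) _

theorem exists_norm_gDist_succ_sub_le {n : ℕ} {τ a t : ℝ} (hτ : τ ∈ Ioo (0 : ℝ) 1) (ha : 0 < a)
    (ht : 0 < t) (y : Fin (n + 1) → ℝ) :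
    ∃ D, ∀ u, ‖gDist (n + 1) τ a t y u - gDist n τ a t (Fin.tail y) u‖ ≤ D * Real.exp (-a * u) := by
  obtain ⟨D, hD⟩ := exists_norm_integral_innerFactor_sub_le n hτ ha
    (c := (n + 1) * a) (by positivity) ht
  have hn := integrable_gIntegrand hτ ha ht n (Fin.tail y)
  refine ⟨(1 / (2 * Real.pi)) ^ (n + 1) * (D * Real.exp ((n + 1) * a * y 0) *
    ∫ φ, ‖gIntegrand n τ a t (Fin.tail y) 0 φ‖), fun u => ?_⟩
  set J : (Fin n → ℝ) → ℂ := fun φ =>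
    ∫ x, innerFactor τ t (fun j => lineZ a (φ j)) (u - y 0) (lineZ a x) / lineZ a x
  have hprod : Integrable (fun p : ℝ × (Fin n → ℝ) =>
      innerFactor τ t (fun j => lineZ a (p.2 j)) (u - y 0) (lineZ a p.1) / lineZ a p.1 *
        gIntegrand n τ a t (Fin.tail y) u p.2) (volume.prod volume) := by
    refine (((measurePreserving_cons n).integrable_comp_emb
      (MeasurableEquiv.measurableEmbedding _)).2
      (integrable_gIntegrand hτ ha ht (n + 1) y u)).congr (Eventually.of_forall fun p => ?_)
    rw [Function.comp_apply, piFinSuccAbove_zero_symm_apply, gIntegrand_cons]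
  have hsucc : ∫ φ, gIntegrand (n + 1) τ a t y u φ =
      ∫ φ, J φ * gIntegrand n τ a t (Fin.tail y) u φ := by
    rw [← (measurePreserving_cons n).integral_comp']
    simp_rw [piFinSuccAbove_zero_symm_apply, gIntegrand_cons]
    rw [integral_prod_symm _ hprod]
    simp_rw [integral_mul_const]
    rfl
  have hJ : Integrable fun φ => J φ * gIntegrand n τ a t (Fin.tail y) u φ := by
    have := hprod.integral_prod_right
    simp_rw [integral_mul_const] at this
    exact this
  have hdiff : gDist (n + 1) τ a t y u - gDist n τ a t (Fin.tail y) u =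
      (1 / (2 * Real.pi)) ^ (n + 1) *
        ∫ φ, (J φ - 2 * Real.pi) * gIntegrand n τ a t (Fin.tail y) u φ := by
    simp_rw [sub_mul]
    rw [integral_sub hJ ((hn u).const_mul _), integral_const_mul, gDist_eq, gDist_eq, hsucc]
    have h : (1 : ℂ) / (2 * Real.pi) * (2 * Real.pi) = 1 :=
      one_div_mul_cancel (mul_ne_zero two_ne_zero (by exact_mod_cast Real.pi_ne_zero))
    rw [pow_succ]
    linear_combination ((1 : ℂ) / (2 * Real.pi)) ^ n *
      (∫ φ, gIntegrand n τ a t (Fin.tail y) u φ) * h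
  have hexp : Real.exp (-((n + 1) * a) * (u - y 0)) * Real.exp (n * a * u) =
      Real.exp ((n + 1) * a * y 0) * Real.exp (-a * u) := by
    rw [← Real.exp_add, ← Real.exp_add]
    ring_nf
  have hle : ‖∫ φ, (J φ - 2 * Real.pi) * gIntegrand n τ a t (Fin.tail y) u φ‖ ≤
      ∫ φ, D * Real.exp (-((n + 1) * a) * (u - y 0)) *
        (Real.exp (n * a * u) * ‖gIntegrand n τ a t (Fin.tail y) 0 φ‖) := by
    refine norm_integral_le_of_norm_le (((hn 0).norm.const_mul _).const_mul _)
      (Eventually.of_forall fun φ => ?_)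
    rw [norm_mul, ← norm_gIntegrand]
    gcongr
    exact hD _ (fun j => lineZ_re _ _) _
  have hpi : ‖((1 : ℂ) / (2 * Real.pi)) ^ (n + 1)‖ = (1 / (2 * Real.pi)) ^ (n + 1) := by
    simp [abs_of_pos Real.pi_pos]
  rw [hdiff, norm_mul, hpi, mul_assoc]
  refine mul_le_mul_of_nonneg_left (hle.trans_eq ?_) (by positivity)
  rw [integral_const_mul, integral_const_mul]
  linear_combination (D * ∫ φ, ‖gIntegrand n τ a t (Fin.tail y) 0 φ‖) * hexp

theorem tendsto_gDist_atTop {τ a t : ℝ} (hτ : τ ∈ Ioo (0 : ℝ) 1) (ha : 0 < a) (ht : 0 < t) :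
    ∀ (N : ℕ) (y : Fin N → ℝ), Tendsto (fun u => gDist N τ a t y u) atTop (nhds 1)
  | 0, y => by
    refine tendsto_const_nhds.congr fun u => ?_
    rw [gDist, volume_pi, Measure.pi_of_empty _ (fun i => i.elim0)]
    simp
  | n + 1, y => by
    obtain ⟨D, hD⟩ := exists_norm_gDist_succ_sub_le hτ ha ht y
    have hexp : Tendsto (fun u : ℝ => D * Real.exp (-a * u)) atTop (nhds 0) := by
      simpa using (Real.tendsto_exp_atBot.comp
        (tendsto_id.const_mul_atTop_of_neg (neg_neg_of_pos ha))).const_mul D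
    simpa using (squeeze_zero_norm hD hexp).add (tendsto_gDist_atTop hτ ha ht n (Fin.tail y))

/-- `lim_{u→∞} g_N(u) = 1`. -/
theorem gDist_tendsto_one (N : ℕ) (hN : 1 ≤ N) (τ : ℝ) (hτ : τ ∈ Set.Ioo (0 : ℝ) 1)
    (a : ℝ) (ha : 0 < a) (t : ℝ) (ht : 0 < t)
    (y : Fin N → ℝ) (hy : Monotone y) :
    Filter.Tendsto (fun u : ℝ => gDist N τ a t y u) Filter.atTop (nhds 1) := by
  exact tendsto_gDist_atTop hτ ha ht N y
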